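/- Let G be a vertex-weighted graph containing a path v₁v₂v₃v₄v₅ on five distinct vertices such that d(v₂)=d(v₃)=d(v₄)=2 and w(v₁) ≥ w(v₂) ≥ w(v₃), w(v₃) ≤ w(v₄) ≤ w(v₅). Let G' be the graph obtained from G by removing v₂ and v₄, adding the edges v₁v₃ and v₃v₅, replacing the weight of v₁ by w(v₁)+w(v₃)−w(v₂) and the weight of v₅ by w(v₅)+w(v₃)−w(v₄). Then α(G) = α(G') + w(v₂) + w(v₄) − w(v₃). -/

import Mathlib

open scoped Classical

namespace MWIS

variable {V : Type*}

/-- A finset of vertices is an independent set of `G`. -/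
def IsIndepSet (G : SimpleGraph V) (s : Finset V) : Prop :=
  ∀ ⦃a⦄, a ∈ s → ∀ ⦃b⦄, b ∈ s → ¬G.Adj a b

/-- The maximum total weight of an independent set of `G` contained in `A`
(i.e. α of the induced subgraph `G[A]`, with the inherited weights). -/
noncomputable def alphaOn [Fintype V] (G : SimpleGraph V) (w : V → ℝ) (A : Finset V) : ℝ :=
  sSup {x : ℝ | ∃ s : Finset V, s ⊆ A ∧ IsIndepSet G s ∧ x = ∑ v ∈ s, w v}

/-- The maximum total weight of an independent set of `G`. -/
noncomputable def alpha [Fintype V] (G : SimpleGraph V) (w : V → ℝ) : ℝ :=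
  alphaOn G w Finset.univ

/-- The open neighborhood of a vertex, as a finset. -/
noncomputable def nbrs [Fintype V] (G : SimpleGraph V) (v : V) : Finset V :=
  Finset.univ.filter fun u => G.Adj v u

/-- The degree of a vertex. -/
noncomputable def deg [Fintype V] (G : SimpleGraph V) (v : V) : ℕ :=
  (nbrs G v).card

/-- The closed neighborhood `N[v]` of a vertex. -/
noncomputable def closedNbrs [Fintype V] [DecidableEq V] (G : SimpleGraph V) (v : V) : Finset V :=
  insert v (nbrs G v)

/-- The open neighborhood `N(A)` of a vertex set. -/
noncomputable def openNbhd [Fintype V] [DecidableEq V] (G : SimpleGraph V) (A : Finset V) :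
    Finset V :=
  (A.biUnion fun v => nbrs G v) \ A

/-- The closed neighborhood `N[A]` of a vertex set. -/
noncomputable def closedNbhd [Fintype V] [DecidableEq V] (G : SimpleGraph V) (A : Finset V) :
    Finset V :=
  A ∪ A.biUnion fun v => nbrs G v

/-- `s` is a maximum weighted independent set of `G` with weights `w`. -/
def IsMWIS [Fintype V] (G : SimpleGraph V) (w : V → ℝ) (s : Finset V) : Prop :=
  IsIndepSet G s ∧ ∀ t : Finset V, IsIndepSet G t → ∑ v ∈ t, w v ≤ ∑ v ∈ s, w v

/-- `A` is the vertex set of a connected component of the subgraph of `G` induced on `B`: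
`A` is the set of vertices reachable from some `x ∈ B` by paths staying inside `B`. -/
def IsCompOf (G : SimpleGraph V) (B A : Finset V) : Prop :=
  ∃ x ∈ B, ∀ y, y ∈ A ↔ Relation.ReflTransGen (fun a b => a ∈ B ∧ b ∈ B ∧ G.Adj a b) x y

section Auxiliary

variable {G : SimpleGraph V} {s t : Finset V} {a b v x : V}

theorem IsIndepSet.mono (hs : IsIndepSet G s) (hts : t ⊆ s) : IsIndepSet G t :=
  fun _ ha _ hb => hs (hts ha) (hts hb)

theorem IsIndepSet.anti {H : SimpleGraph V} (hGH : G ≤ H) (hs : IsIndepSet H s) :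
    IsIndepSet G s :=
  fun _ ha _ hb hab => hs ha hb (hGH hab)

theorem IsIndepSet.insert [DecidableEq V] (hs : IsIndepSet G s)
    (ha : ∀ y ∈ s, ¬G.Adj a y) : IsIndepSet G (insert a s) := by
  intro y hy z hz hyz
  rcases Finset.mem_insert.1 hy with rfl | hys <;> rcases Finset.mem_insert.1 hz with rfl | hzs
  · exact hyz.ne rfl
  · exact ha z hzs hyz
  · exact ha y hys hyz.symm
  · exact hs hys hzs hyz

/-- A vertex of degree two has no neighbours besides two given distinct ones. -/
theorem eq_or_eq_of_adj_of_deg_eq_two [Fintype V] (hd : deg G v = 2) (ha : G.Adj v a)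
    (hb : G.Adj v b) (hab : a ≠ b) (hx : G.Adj v x) : x = a ∨ x = b := by
  have hsub : ({a, b} : Finset V) ⊆ nbrs G v := by
    intro y hy
    rcases Finset.mem_insert.1 hy with rfl | hy
    · simpa [nbrs] using ha
    · rw [Finset.mem_singleton.1 hy]
      simpa [nbrs] using hb
  have heq : ({a, b} : Finset V) = nbrs G v :=
    Finset.eq_of_subset_of_card_le hsub (by rw [Finset.card_pair hab]; exact hd.le)
  have hmem : x ∈ ({a, b} : Finset V) := by
    rw [heq]
    simpa [nbrs] using hx
  simpa using hmem

/-- A vertex of degree two can be added to an independent set avoiding its two neighbours. -/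
theorem IsIndepSet.insert_of_deg_eq_two [Fintype V] [DecidableEq V] (hs : IsIndepSet G s)
    (hd : deg G v = 2) (ha : G.Adj v a) (hb : G.Adj v b) (hab : a ≠ b)
    (has : a ∉ s) (hbs : b ∉ s) : IsIndepSet G (Insert.insert v s) := by
  refine hs.insert fun y hy hvy => ?_
  rcases eq_or_eq_of_adj_of_deg_eq_two hd ha hb hab hvy with rfl | rfl
  · exact has hy
  · exact hbs hy

theorem le_alphaOn [Fintype V] {w : V → ℝ} {A : Finset V} (hsA : s ⊆ A)
    (hs : IsIndepSet G s) : ∑ v ∈ s, w v ≤ alphaOn G w A := by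
  refine le_csSup (Set.Finite.bddAbove ?_) ⟨s, hsA, hs, rfl⟩
  refine (Set.finite_range fun s : Finset V => ∑ v ∈ s, w v).subset ?_
  rintro _ ⟨t, -, -, rfl⟩
  exact ⟨t, rfl⟩

theorem alphaOn_le [Fintype V] {w : V → ℝ} {A : Finset V} {c : ℝ}
    (h : ∀ s ⊆ A, IsIndepSet G s → ∑ v ∈ s, w v ≤ c) : alphaOn G w A ≤ c := by
  refine csSup_le ⟨0, ∅, Finset.empty_subset _, by simp [IsIndepSet], by simp⟩ ?_
  rintro _ ⟨s, hsA, hs, rfl⟩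
  exact h s hsA hs

theorem sum_eq_sum_erase_add_ite [DecidableEq V] (s : Finset V) (w : V → ℝ) (a : V) :
    ∑ v ∈ s, w v = ∑ v ∈ s.erase a, w v + if a ∈ s then w a else 0 := by
  split_ifs with h
  · exact (Finset.sum_erase_add s w h).symm
  · rw [Finset.erase_eq_of_notMem h, add_zero]

theorem sum_update_eq [DecidableEq V] (s : Finset V) (w : V → ℝ) (a : V) (c : ℝ) :
    ∑ v ∈ s, Function.update w a c v = ∑ v ∈ s, w v + if a ∈ s then c - w a else 0 := by
  split_ifs with h
  · rw [Finset.sum_update_of_mem h, Finset.sdiff_singleton_eq_erase,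
      ← Finset.sum_erase_add s w h]
    ring
  · rw [Finset.sum_update_of_notMem h, add_zero]

end Auxiliary

/-- for a path `v₁v₂v₃v₄v₅` on five distinct vertices with
`d(v₂) = d(v₃) = d(v₄) = 2` and `w(v₁) ≥ w(v₂) ≥ w(v₃) ≤ w(v₄) ≤ w(v₅)`:
remove `v₂, v₄`, add the edges `v₁v₃` and `v₃v₅`, give `v₁` the weight
`w(v₁) + w(v₃) − w(v₂)` and `v₅` the weight `w(v₅) + w(v₃) − w(v₄)`.
Then `α(G) = α(G') + w(v₂) + w(v₄) − w(v₃)`. -/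
theorem stmt8 [Fintype V] [DecidableEq V] (G : SimpleGraph V) (w : V → ℝ)
    (hw : ∀ x, 0 < w x) (v₁ v₂ v₃ v₄ v₅ : V)
    (hdist : List.Pairwise (· ≠ ·) [v₁, v₂, v₃, v₄, v₅])
    (e12 : G.Adj v₁ v₂) (e23 : G.Adj v₂ v₃) (e34 : G.Adj v₃ v₄) (e45 : G.Adj v₄ v₅)
    (hd2 : deg G v₂ = 2) (hd3 : deg G v₃ = 2) (hd4 : deg G v₄ = 2)
    (hw12 : w v₂ ≤ w v₁) (hw23 : w v₃ ≤ w v₂) (hw34 : w v₃ ≤ w v₄) (hw45 : w v₄ ≤ w v₅) :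
    alpha G w =
      alphaOn (G ⊔ SimpleGraph.fromRel fun x y => (x = v₁ ∧ y = v₃) ∨ (x = v₃ ∧ y = v₅))
        (Function.update (Function.update w v₁ (w v₁ + w v₃ - w v₂)) v₅ (w v₅ + w v₃ - w v₄))
        (Finset.univ \ {v₂, v₄}) + w v₂ + w v₄ - w v₃ := by
  obtain ⟨⟨n12, n13, n14, n15⟩, ⟨n23, n24, n25⟩, ⟨n34, n35⟩, n45⟩ :
      (v₁ ≠ v₂ ∧ v₁ ≠ v₃ ∧ v₁ ≠ v₄ ∧ v₁ ≠ v₅) ∧ (v₂ ≠ v₃ ∧ v₂ ≠ v₄ ∧ v₂ ≠ v₅) ∧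
        (v₃ ≠ v₄ ∧ v₃ ≠ v₅) ∧ v₄ ≠ v₅ := by
    simpa [and_assoc] using hdist
  set H := G ⊔ SimpleGraph.fromRel fun x y => (x = v₁ ∧ y = v₃) ∨ (x = v₃ ∧ y = v₅) with hH
  have hGH : G ≤ H := le_sup_left
  have f13 : H.Adj v₁ v₃ := by simp [hH, n13]
  have f35 : H.Adj v₃ v₅ := by simp [hH, n35]
  have hHG : ∀ {s : Finset V}, v₃ ∉ s → IsIndepSet G s → IsIndepSet H s := by
    intro s h3 hs x hx y hy hxy
    rw [hH, SimpleGraph.sup_adj, SimpleGraph.fromRel_adj] at hxy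
    rcases hxy with hxy | ⟨-, (⟨-, rfl⟩ | ⟨rfl, -⟩) | (⟨-, rfl⟩ | ⟨rfl, -⟩)⟩
    · exact hs hx hy hxy
    all_goals exact h3 ‹_›
  have hsum : ∀ s : Finset V,
      ∑ v ∈ s, Function.update (Function.update w v₁ (w v₁ + w v₃ - w v₂)) v₅
        (w v₅ + w v₃ - w v₄) v =
      ∑ v ∈ s, w v + (if v₁ ∈ s then w v₃ - w v₂ else 0) +
        if v₅ ∈ s then w v₃ - w v₄ else 0 := by
    intro s
    rw [sum_update_eq, sum_update_eq, Function.update_of_ne n15.symm,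
      show w v₁ + w v₃ - w v₂ - w v₁ = w v₃ - w v₂ by ring,
      show w v₅ + w v₃ - w v₄ - w v₅ = w v₃ - w v₄ by ring]
  have p3 := hw v₃
  apply le_antisymm
  · refine alphaOn_le fun s _ hs => ?_
    set r := ((s.erase v₂).erase v₃).erase v₄ with hr
    have r2 : v₂ ∉ r := by simp [hr]
    have r3 : v₃ ∉ r := by simp [hr]
    have r4 : v₄ ∉ r := by simp [hr]
    have r1 : v₁ ∈ r ↔ v₁ ∈ s := by simp [hr, n12, n13, n14]
    have r5 : v₅ ∈ r ↔ v₅ ∈ s := by simp [hr, n25.symm, n35.symm, n45.symm]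
    have hrG : IsIndepSet G r := hs.mono (by
      intro x hx
      simp only [hr, Finset.mem_erase] at hx
      exact hx.2.2.2)
    have hrA : r ⊆ Finset.univ \ {v₂, v₄} := by
      intro x hx
      have h2 : x ≠ v₂ := fun h => r2 (h ▸ hx)
      have h4 : x ≠ v₄ := fun h => r4 (h ▸ hx)
      simp [h2, h4]
    have hs_sum : ∑ v ∈ s, w v = ∑ v ∈ r, w v + (if v₄ ∈ s then w v₄ else 0) +
        (if v₃ ∈ s then w v₃ else 0) + if v₂ ∈ s then w v₂ else 0 := by
      rw [sum_eq_sum_erase_add_ite s w v₂, sum_eq_sum_erase_add_ite (s.erase v₂) w v₃,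
        sum_eq_sum_erase_add_ite ((s.erase v₂).erase v₃) w v₄]
      simp [hr, n23.symm, n24.symm, n34.symm]
    have c12 : v₁ ∈ s → v₂ ∉ s := fun h h' => hs h h' e12
    have c23 : v₂ ∈ s → v₃ ∉ s := fun h h' => hs h h' e23
    have c34 : v₃ ∈ s → v₄ ∉ s := fun h h' => hs h h' e34
    have c45 : v₄ ∈ s → v₅ ∉ s := fun h h' => hs h h' e45
    by_cases h15 : v₁ ∈ s ∨ v₅ ∈ s
    · have key := le_alphaOn (w := Function.update (Function.update w v₁ (w v₁ + w v₃ - w v₂)) v₅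
        (w v₅ + w v₃ - w v₄)) hrA (hHG r3 hrG)
      rw [hsum] at key
      simp only [r1, r5] at key
      rw [hs_sum]
      rcases h15 with h1 | h5
      · simp only [h1, c12 h1, if_true, if_false] at key ⊢
        split_ifs at key ⊢ <;>
          first
          | exact absurd ‹v₅ ∈ s› (c45 ‹_›)
          | exact absurd ‹v₄ ∈ s› (c34 ‹_›)
          | linarith
      · have h4 : v₄ ∉ s := fun h => c45 h h5
        simp only [h5, h4, if_true, if_false] at key ⊢
        split_ifs at key ⊢ <;>
          first
          | exact absurd ‹v₂ ∈ s› (c12 ‹_›)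
          | exact absurd ‹v₃ ∈ s› (c23 ‹_›)
          | linarith
    · rw [not_or] at h15
      have hins : IsIndepSet H (insert v₃ r) := by
        refine (hHG r3 hrG).insert fun y hy hadj => ?_
        rw [hH, SimpleGraph.sup_adj, SimpleGraph.fromRel_adj] at hadj
        rcases hadj with hadj | ⟨-, (⟨h, -⟩ | ⟨-, rfl⟩) | (⟨rfl, -⟩ | ⟨-, h⟩)⟩
        · rcases eq_or_eq_of_adj_of_deg_eq_two hd3 e23.symm e34 n24 hadj with rfl | rfl
          · exact r2 hy
          · exact r4 hy
        · exact n13 h.symm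
        · exact h15.2 (r5.1 hy)
        · exact h15.1 (r1.1 hy)
        · exact n35 h
      have hA : insert v₃ r ⊆ Finset.univ \ {v₂, v₄} :=
        Finset.insert_subset (by simp [n23.symm, n34]) hrA
      have key := le_alphaOn (w := Function.update (Function.update w v₁ (w v₁ + w v₃ - w v₂)) v₅
        (w v₅ + w v₃ - w v₄)) hA hins
      rw [hsum, Finset.sum_insert r3] at key
      simp only [Finset.mem_insert, r1, r5, h15, n13, n35.symm, or_self, if_false] at key
      rw [hs_sum]
      split_ifs <;>
        first
        | exact absurd ‹v₃ ∈ s› (c23 ‹_›)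
        | exact absurd ‹v₄ ∈ s› (c34 ‹_›)
        | linarith
  · suffices h : alphaOn H (Function.update (Function.update w v₁ (w v₁ + w v₃ - w v₂)) v₅
        (w v₅ + w v₃ - w v₄)) (Finset.univ \ {v₂, v₄}) ≤ alpha G w - w v₂ - w v₄ + w v₃ by
      linarith
    refine alphaOn_le fun s hsA hs => ?_
    rw [hsum]
    have s2 : v₂ ∉ s := fun h => by simpa using hsA h
    have s4 : v₄ ∉ s := fun h => by simpa using hsA h
    have hsG : IsIndepSet G s := hs.anti hGH
    have bound : ∀ {t : Finset V}, IsIndepSet G t → ∑ v ∈ t, w v ≤ alpha G w :=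
      fun ht => le_alphaOn (Finset.subset_univ _) ht
    -- replacing `v₃` by `v₂` and `v₄`
    have both : v₁ ∉ s → v₅ ∉ s → ∑ v ∈ s.erase v₃, w v + w v₂ + w v₄ ≤ alpha G w := by
      intro h1 h5
      have ht : IsIndepSet G (insert v₄ (s.erase v₃)) :=
        (hsG.mono (Finset.erase_subset _ _)).insert_of_deg_eq_two hd4 e34.symm e45 n35
          (by simp) (by simp [h5])
      have key := bound (ht.insert_of_deg_eq_two hd2 e12.symm e23 n13
        (by simp [n14, h1]) (by simp [n34]))
      rw [Finset.sum_insert (by simp [n24, s2]), Finset.sum_insert (by simp [s4])] at key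
      linarith
    by_cases h1 : v₁ ∈ s <;> by_cases h5 : v₅ ∈ s
    · have h3 : v₃ ∉ s := fun h => hs h1 h f13
      have key := bound (hsG.insert_of_deg_eq_two hd3 e23.symm e34 n24 s2 s4)
      rw [Finset.sum_insert h3] at key
      simp only [h1, h5, if_true]
      linarith
    · have h3 : v₃ ∉ s := fun h => hs h1 h f13
      have key := bound (hsG.insert_of_deg_eq_two hd4 e34.symm e45 n35 h3 h5)
      rw [Finset.sum_insert s4] at key
      simp only [h1, h5, if_true, if_false]
      linarith
    · have h3 : v₃ ∉ s := fun h => hs h h5 f35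
      have key := bound (hsG.insert_of_deg_eq_two hd2 e12.symm e23 n13 h1 h3)
      rw [Finset.sum_insert s2] at key
      simp only [h1, h5, if_true, if_false]
      linarith
    · have key := both h1 h5
      rw [sum_eq_sum_erase_add_ite s w v₃]
      simp only [h1, h5, if_false]
      split_ifs <;> linarith

end MWIS
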